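/- arXiv:2409.16105 — 2 statements merged into one kernel-verified Lean document; each statement's English description precedes it below -/
import Mathlib

section
/- Let X be a vector space over ℂ equipped with an increasing family of seminorms (pₖ)ₖ≥₁ (i.e. pₖ(x) ≤ pₖ₊₁(x) for all x and k), and define d(x, y) = Σₖ₌₁^∞ 2⁻ᵏ min(1, pₖ(x − y)) for x, y ∈ X. Then a linear operator T : X → X satisfies d(Tx, Ty) = d(x, y) for all x, y ∈ X if and only if pₖ(Tx) = pₖ(x) for every x ∈ X and every k ≥ 1. -/
theorem aux_summable (a : ℕ → ℝ) (ha : ∀ k, 0 ≤ a k) (s : ℝ) (hs : 0 ≤ s) :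
    Summable (fun k : ℕ => (2 : ℝ)⁻¹ ^ (k + 1) * min s (a k)) := by
  have h1 : Summable (fun k : ℕ => (2 : ℝ)⁻¹ ^ k * s) :=
    (summable_geometric_of_lt_one (by norm_num) (by norm_num)).mul_right s
  have h2 : Summable (fun k : ℕ => (2 : ℝ)⁻¹ ^ (k + 1) * s) :=
    (summable_nat_add_iff (f := fun k : ℕ => (2 : ℝ)⁻¹ ^ k * s) 1).2 h1
  refine Summable.of_nonneg_of_le (fun k => ?_) (fun k => ?_) h2
  · exact mul_nonneg (by positivity) (le_min hs (ha k))
  · exact mul_le_mul_of_nonneg_left (min_le_left _ _) (by positivity)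

theorem aux_le (a b : ℕ → ℝ) (ha : ∀ k, 0 ≤ a k) (hb : ∀ k, 0 ≤ b k)
    (ma : Monotone a) (mb : Monotone b)
    (h : ∀ s : ℝ, 0 ≤ s → ∑' k : ℕ, (2 : ℝ)⁻¹ ^ (k + 1) * min s (a k)
      = ∑' k : ℕ, (2 : ℝ)⁻¹ ^ (k + 1) * min s (b k)) (n : ℕ) : b n ≤ a n := by
  by_contra! hlt
  have A1 := aux_summable a ha (a n) (ha n)
  have A2 := aux_summable a ha (b n) (hb n)
  have B1 := aux_summable b hb (a n) (ha n)
  have B2 := aux_summable b hb (b n) (hb n)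
  have key : ∑' k : ℕ, ((2 : ℝ)⁻¹ ^ (k + 1) * min (b n) (a k)
        + (2 : ℝ)⁻¹ ^ (k + 1) * min (a n) (b k))
      < ∑' k : ℕ, ((2 : ℝ)⁻¹ ^ (k + 1) * min (b n) (b k)
        + (2 : ℝ)⁻¹ ^ (k + 1) * min (a n) (a k)) := by
    refine Summable.tsum_lt_tsum (i := n) (fun k => ?_) ?_ (A2.add B1) (B2.add A1)
    · simp only [← mul_add]
      refine mul_le_mul_of_nonneg_left ?_ (by positivity)
      rcases le_total k n with hk | hk
      · have h1 := ma hk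
        have h2 := mb hk
        rw [min_eq_right (h1.trans hlt.le), min_eq_right h1, min_eq_right h2]
        linarith [min_le_right (a n) (b k)]
      · have h1 := ma hk
        have h2 := mb hk
        rw [min_eq_left h1, min_eq_left h2, min_eq_left (hlt.le.trans h2)]
        linarith [min_le_left (b n) (a k)]
    · simp only [← mul_add]
      refine mul_lt_mul_of_pos_left ?_ (by positivity)
      rw [min_eq_right hlt.le, min_self, min_self, min_eq_left hlt.le]
      linarith
  rw [A2.tsum_add B1, B2.tsum_add A1, h _ (ha n), h _ (hb n)] at key
  exact lt_irrefl _ key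

/-- A linear operator on a space with an increasing family of seminorms `(pₖ)ₖ≥₁` is isometric
for the distance `d(x,y) = Σₖ 2⁻ᵏ min(1, pₖ(x−y))` iff it preserves every seminorm.
Here `p k` denotes the seminorm `p_{k+1}` of the family, so the sum over `k : ℕ` corresponds to
`Σ_{k=1}^∞ 2⁻ᵏ min(1, pₖ(x−y))`. -/
theorem stmt2 (X : Type*) [AddCommGroup X] [Module ℂ X]
    (p : ℕ → Seminorm ℂ X) (hmono : ∀ (k : ℕ) (x : X), p k x ≤ p (k + 1) x)
    (d : X → X → ℝ)
    (hd : ∀ x y : X, d x y = ∑' k : ℕ, (2 : ℝ)⁻¹ ^ (k + 1) * min 1 (p k (x - y)))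
    (T : X →ₗ[ℂ] X) :
    (∀ x y : X, d (T x) (T y) = d x y) ↔ ∀ (x : X) (k : ℕ), p k (T x) = p k x := by
  constructor
  · intro h x
    have hm : ∀ y, Monotone (fun k => p k y) := fun y =>
      monotone_nat_of_le_succ (fun k => hmono k y)
    have hsc : ∀ (s : ℝ), 0 < s → ∀ y : X,
        ∑' k : ℕ, (2 : ℝ)⁻¹ ^ (k + 1) * min s (p k y) = s * d (((s⁻¹ : ℝ) : ℂ) • y) 0 := by
      intro s hs y
      rw [hd, ← tsum_mul_left]
      refine tsum_congr (fun k => ?_)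
      rw [sub_zero, map_smul_eq_mul, Complex.norm_real, Real.norm_of_nonneg (by positivity),
        mul_left_comm, mul_min_of_nonneg _ _ hs.le, mul_one, mul_inv_cancel_left₀ hs.ne']
    have hg : ∀ s : ℝ, 0 ≤ s → ∑' k : ℕ, (2 : ℝ)⁻¹ ^ (k + 1) * min s (p k (T x))
        = ∑' k : ℕ, (2 : ℝ)⁻¹ ^ (k + 1) * min s (p k x) := by
      intro s hs
      rcases hs.eq_or_lt with rfl | hs
      · simp
      · rw [hsc s hs, hsc s hs, ← h (_ • x) 0, map_smul, map_zero]
    intro k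
    apply le_antisymm
    · exact aux_le (fun k => p k x) (fun k => p k (T x)) (fun k => apply_nonneg _ _)
        (fun k => apply_nonneg _ _) (hm _) (hm _) (fun s hs => (hg s hs).symm) k
    · exact aux_le (fun k => p k (T x)) (fun k => p k x) (fun k => apply_nonneg _ _)
        (fun k => apply_nonneg _ _) (hm _) (hm _) hg k
  · intro h x y
    simp only [hd, ← map_sub, h]
end

section
/- Let X be a vector space over ℂ equipped with an increasing family of seminorms (pₖ)ₖ≥₁ (i.e. pₖ(x) ≤ pₖ₊₁(x) for all x and k), and define d'(x, y) = Σₖ₌₁^∞ 2⁻ᵏ pₖ(x − y)/(1 + pₖ(x − y)) for x, y ∈ X. Then a linear operator T : X → X satisfies d'(Tx, Ty) = d'(x, y) for all x, y ∈ X if and only if pₖ(Tx) = pₖ(x) for every x ∈ X and every k ≥ 1. -/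
lemma aux_summable_s3 (f : ℕ → ℝ) (C : ℝ) (hf : ∀ k, |f k| ≤ C) :
    Summable (fun k => (2 : ℝ)⁻¹ ^ (k + 1) * f k) ∧
      |∑' k, (2 : ℝ)⁻¹ ^ (k + 1) * f k| ≤ C := by
  have h1 : HasSum (fun k : ℕ => (2 : ℝ)⁻¹ ^ (k + 1) * C) C := by
    have h := (hasSum_geometric_two).mul_right ((2 : ℝ)⁻¹ * C)
    have e1 : (fun k : ℕ => (2 : ℝ)⁻¹ ^ (k + 1) * C)
        = fun i : ℕ => (1 / 2 : ℝ) ^ i * ((2 : ℝ)⁻¹ * C) := by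
      funext k
      rw [pow_succ, one_div]; ring
    have e2 : (2 : ℝ) * ((2 : ℝ)⁻¹ * C) = C := by ring
    rw [e2] at h
    rw [e1]
    exact h
  have h2 : ∀ k, ‖(2 : ℝ)⁻¹ ^ (k + 1) * f k‖ ≤ (2 : ℝ)⁻¹ ^ (k + 1) * C := by
    intro k
    rw [Real.norm_eq_abs, abs_mul, abs_of_nonneg (by positivity : (0:ℝ) ≤ (2 : ℝ)⁻¹ ^ (k + 1))]
    exact mul_le_mul_of_nonneg_left (hf k) (by positivity)
  exact ⟨Summable.of_norm_bounded h1.summable h2, tsum_of_norm_bounded h1 h2⟩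

lemma aux_le_s3 (u w : ℕ → ℝ) (hu : ∀ k, 0 < u k ∧ u k ≤ 1) (hw : ∀ k, 0 < w k ∧ w k ≤ 1)
    (hwm : Antitone w)
    (h : ∀ m : ℕ, ∑' k, (2 : ℝ)⁻¹ ^ (k + 1) * u k ^ (m + 1)
      = ∑' k, (2 : ℝ)⁻¹ ^ (k + 1) * w k ^ (m + 1))
    (k : ℕ) (hk : ∀ j < k, u j = w j) : u k ≤ w k := by
  by_contra! hlt
  have key : ∀ m : ℕ, (2 : ℝ)⁻¹ ^ (k + 1) * u k ^ (m + 1) ≤ w k ^ (m + 1) := by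
    intro m
    have su := (aux_summable_s3 (fun k => u k ^ (m + 1)) 1 (fun j => by
      rw [abs_of_nonneg (pow_nonneg (hu j).1.le _)]
      exact pow_le_one₀ (hu j).1.le (hu j).2)).1
    have sw := (aux_summable_s3 (fun k => w k ^ (m + 1)) 1 (fun j => by
      rw [abs_of_nonneg (pow_nonneg (hw j).1.le _)]
      exact pow_le_one₀ (hw j).1.le (hw j).2)).1
    have e1 := su.sum_le_tsum (Finset.range (k + 1))
      (fun j _ => mul_nonneg (by positivity) (pow_nonneg (hu j).1.le _))
    have e2 := sw.sum_add_tsum_nat_add k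
    rw [Finset.sum_range_succ] at e1
    have e3 : ∑ j ∈ Finset.range k, (2 : ℝ)⁻¹ ^ (j + 1) * u j ^ (m + 1)
        = ∑ j ∈ Finset.range k, (2 : ℝ)⁻¹ ^ (j + 1) * w j ^ (m + 1) :=
      Finset.sum_congr rfl (fun j hj => by rw [hk j (Finset.mem_range.1 hj)])
    have e4 : ∑' j, (2 : ℝ)⁻¹ ^ (j + k + 1) * w (j + k) ^ (m + 1) ≤ w k ^ (m + 1) := by
      have := aux_summable_s3 (fun j => (2 : ℝ)⁻¹ ^ k * w (j + k) ^ (m + 1)) (w k ^ (m + 1))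
        (fun j => by
          have h0 := pow_nonneg (hw (j + k)).1.le (m + 1)
          rw [abs_of_nonneg (mul_nonneg (by positivity) h0)]
          have h1 : w (j + k) ^ (m + 1) ≤ w k ^ (m + 1) :=
            pow_le_pow_left₀ (hw _).1.le (hwm (by omega)) _
          have h2 : (2 : ℝ)⁻¹ ^ k ≤ 1 := pow_le_one₀ (by norm_num) (by norm_num)
          nlinarith)
      refine le_trans (le_of_eq ?_) (le_trans (le_abs_self _) this.2)
      congr 1
      funext j
      ring
    have := h m
    linarith
  have hq0 : 0 ≤ w k / u k := div_nonneg (hw k).1.le (hu k).1.le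
  have hq : w k / u k < 1 := (div_lt_one (hu k).1).2 hlt
  obtain ⟨m, hm⟩ := exists_pow_lt_of_lt_one (by positivity : (0:ℝ) < (2 : ℝ)⁻¹ ^ (k + 1)) hq
  have h1 := pow_le_pow_of_le_one hq0 hq.le (Nat.le_succ m)
  have h2 : (w k / u k) ^ (m + 1) < (2 : ℝ)⁻¹ ^ (k + 1) := lt_of_le_of_lt h1 hm
  rw [div_pow, div_lt_iff₀ (pow_pos (hu k).1 _)] at h2
  linarith [key m]

lemma aux_bd (u s : ℝ) (hu : 0 < u ∧ u ≤ 1) (hs0 : 0 ≤ s) (hs : s ≤ 1 / 2) (n : ℕ) :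
    |u * (1 - u) ^ n / (1 - s * (1 - u))| ≤ 2 := by
  have h1 : 1 / 2 ≤ 1 - s * (1 - u) := by nlinarith [hu.1, hu.2]
  have h2 : (1 - u) ^ n ≤ 1 := pow_le_one₀ (by linarith [hu.2]) (by linarith [hu.1])
  have h3 : 0 ≤ (1 - u) ^ n := pow_nonneg (by linarith [hu.2]) _
  rw [abs_of_nonneg (div_nonneg (mul_nonneg hu.1.le h3) (by linarith)),
    div_le_iff₀ (by linarith)]
  nlinarith [hu.1, hu.2]

noncomputable def auxS (u : ℕ → ℝ) (n : ℕ) (s : ℝ) : ℝ :=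
  ∑' k, (2 : ℝ)⁻¹ ^ (k + 1) * (u k * (1 - u k) ^ n / (1 - s * (1 - u k)))

lemma auxS_rec (u : ℕ → ℝ) (hu : ∀ k, 0 < u k ∧ u k ≤ 1) (n : ℕ) (s : ℝ) (hs0 : 0 ≤ s)
    (hs : s ≤ 1 / 2) : auxS u n s = auxS u n 0 + s * auxS u (n + 1) s := by
  unfold auxS
  have s1 := (aux_summable_s3 _ 2 (fun k => aux_bd (u k) 0 (hu k) le_rfl (by norm_num) n)).1
  have s2 := (aux_summable_s3 _ 2 (fun k => aux_bd (u k) s (hu k) hs0 hs (n + 1))).1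
  rw [← tsum_mul_left, ← s1.tsum_add (s2.mul_left s)]
  congr 1
  funext k
  have h1 : 1 - s * (1 - u k) ≠ 0 := by
    have := hu k
    nlinarith [this.1, this.2]
  generalize hq : 1 - s * (1 - u k) = q at h1
  rw [zero_mul, sub_zero, div_one, pow_succ (1 - u k) n]
  generalize (1 - u k) ^ n = A
  field_simp
  linear_combination A * u k * hq

lemma aux_moments (u w : ℕ → ℝ) (hu : ∀ k, 0 < u k ∧ u k ≤ 1) (hw : ∀ k, 0 < w k ∧ w k ≤ 1)
    (h : ∀ s : ℝ, 0 ≤ s → s ≤ 1 / 2 → auxS u 0 s = auxS w 0 s) (n : ℕ) :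
    ∀ s : ℝ, 0 ≤ s → s ≤ 1 / 2 → auxS u n s = auxS w n s := by
  induction n with
  | zero => exact h
  | succ n ih =>
    have pos : ∀ s : ℝ, 0 < s → s ≤ 1 / 2 → auxS u (n + 1) s = auxS w (n + 1) s := by
      intro s hs0 hs
      have a1 := auxS_rec u hu n s hs0.le hs
      have a2 := auxS_rec w hw n s hs0.le hs
      have a3 := ih s hs0.le hs
      have a4 := ih 0 le_rfl (by norm_num)
      have : s * auxS u (n + 1) s = s * auxS w (n + 1) s := by linarith
      exact mul_left_cancel₀ hs0.ne' this
    intro s hs0 hs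
    rcases hs0.eq_or_lt with rfl | hs0
    · by_contra hne
      set e := |auxS u (n + 1) 0 - auxS w (n + 1) 0| with he
      have hepos : 0 < e := abs_pos.2 (sub_ne_zero.2 hne)
      set r := min (1 / 2) (e / 8) with hr
      have hr0 : 0 < r := lt_min (by norm_num) (by positivity)
      have hr1 : r ≤ 1 / 2 := min_le_left _ _
      have hr2 : r ≤ e / 8 := min_le_right _ _
      have a1 := auxS_rec u hu (n + 1) r hr0.le hr1
      have a2 := auxS_rec w hw (n + 1) r hr0.le hr1
      have a3 := pos r hr0 hr1
      have b1 : |auxS u (n + 1 + 1) r| ≤ 2 :=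
        (aux_summable_s3 _ 2 (fun k => aux_bd (u k) r (hu k) hr0.le hr1 (n + 1 + 1))).2
      have b2 : |auxS w (n + 1 + 1) r| ≤ 2 :=
        (aux_summable_s3 _ 2 (fun k => aux_bd (w k) r (hw k) hr0.le hr1 (n + 1 + 1))).2
      have c : auxS u (n + 1) 0 - auxS w (n + 1) 0
          = r * (auxS w (n + 1 + 1) r - auxS u (n + 1 + 1) r) := by linarith
      have c2 : e ≤ r * 4 := by
        rw [he, c, abs_mul, abs_of_pos hr0]
        refine mul_le_mul_of_nonneg_left ?_ hr0.le
        rw [abs_le] at *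
        constructor <;> linarith [b1.1, b1.2, b2.1, b2.2]
      linarith
    · exact pos s hs0 hs

lemma aux_moments2 (u w : ℕ → ℝ) (hu : ∀ k, 0 < u k ∧ u k ≤ 1) (hw : ∀ k, 0 < w k ∧ w k ≤ 1)
    (h : ∀ s : ℝ, 0 ≤ s → s ≤ 1 / 2 → auxS u 0 s = auxS w 0 s) (m : ℕ) :
    ∀ n : ℕ, ∑' k, (2 : ℝ)⁻¹ ^ (k + 1) * (u k ^ (m + 1) * (1 - u k) ^ n)
      = ∑' k, (2 : ℝ)⁻¹ ^ (k + 1) * (w k ^ (m + 1) * (1 - w k) ^ n) := by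
  induction m with
  | zero =>
    intro n
    have := aux_moments u w hu hw h n 0 le_rfl (by norm_num)
    simpa [auxS] using this
  | succ m ih =>
    intro n
    have step : ∀ v : ℕ → ℝ, (∀ k, 0 < v k ∧ v k ≤ 1) →
        ∑' k, (2 : ℝ)⁻¹ ^ (k + 1) * (v k ^ (m + 1 + 1) * (1 - v k) ^ n)
        = ∑' k, (2 : ℝ)⁻¹ ^ (k + 1) * (v k ^ (m + 1) * (1 - v k) ^ n)
        - ∑' k, (2 : ℝ)⁻¹ ^ (k + 1) * (v k ^ (m + 1) * (1 - v k) ^ (n + 1)) := by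
      intro v hv
      have b : ∀ n k, |v k ^ (m + 1) * (1 - v k) ^ n| ≤ 1 := by
        intro n k
        have h1 := pow_nonneg (hv k).1.le (m + 1)
        have h2 : 0 ≤ (1 - v k) ^ n := pow_nonneg (by linarith [(hv k).2]) n
        rw [abs_of_nonneg (mul_nonneg h1 h2)]
        exact mul_le_one₀ (pow_le_one₀ (hv k).1.le (hv k).2) h2
          (pow_le_one₀ (by linarith [(hv k).2]) (by linarith [(hv k).1]))
      rw [← (aux_summable_s3 _ 1 (b n)).1.tsum_sub (aux_summable_s3 _ 1 (b (n + 1))).1]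
      congr 1
      funext k
      ring
    rw [step u hu, step w hw, ih, ih]

lemma aux_conv (a : ℕ → ℝ) (ha : ∀ k, 0 ≤ a k) (s : ℝ) (hs : s ≤ 1 / 2) :
    auxS (fun k => 1 / (1 + a k)) 0 s = (∑' k, (2 : ℝ)⁻¹ ^ (k + 1) * 1)
      - ∑' k, (2 : ℝ)⁻¹ ^ (k + 1) * ((1 - s) * a k / (1 + (1 - s) * a k)) := by
  have h1 := (aux_summable_s3 (fun _ => 1) 1 (fun k => by simp)).1
  have h2 := (aux_summable_s3 (fun k => (1 - s) * a k / (1 + (1 - s) * a k)) 1 (fun k => by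
    have : 0 ≤ (1 - s) * a k := mul_nonneg (by linarith) (ha k)
    rw [abs_of_nonneg (by positivity), div_le_one (by positivity)]
    linarith)).1
  rw [← h1.tsum_sub h2]
  unfold auxS
  congr 1
  funext k
  have h3 : 0 ≤ (1 - s) * a k := mul_nonneg (by linarith) (ha k)
  have h4 : 0 < 1 + a k := by linarith [ha k]
  have h5 : 1 - s * (1 - 1 / (1 + a k)) = (1 + (1 - s) * a k) / (1 + a k) := by
    field_simp
    ring
  have h6 : 1 + (1 - s) * a k ≠ 0 := by linarith
  rw [h5, pow_zero, mul_one, div_div_div_cancel_right₀ h4.ne']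
  generalize (1 - s) * a k = r at h6
  field_simp
  ring

lemma aux_main (a b : ℕ → ℝ) (ha : ∀ k, 0 ≤ a k) (hb : ∀ k, 0 ≤ b k) (am : Monotone a)
    (bm : Monotone b)
    (h : ∀ t : ℝ, 0 < t → ∑' k, (2 : ℝ)⁻¹ ^ (k + 1) * (t * a k / (1 + t * a k))
      = ∑' k, (2 : ℝ)⁻¹ ^ (k + 1) * (t * b k / (1 + t * b k))) (k : ℕ) : a k = b k := by
  have hu : ∀ a : ℕ → ℝ, (∀ k, 0 ≤ a k) → ∀ k, 0 < 1 / (1 + a k) ∧ 1 / (1 + a k) ≤ 1 := by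
    intro a ha k
    have := ha k
    exact ⟨by positivity, by rw [div_le_one (by positivity)]; linarith⟩
  have anti : ∀ a : ℕ → ℝ, (∀ k, 0 ≤ a k) → Monotone a → Antitone (fun k => 1 / (1 + a k)) := by
    intro a ha am i j hij
    exact one_div_le_one_div_of_le (by linarith [ha i]) (by linarith [am hij])
  have hS : ∀ s : ℝ, 0 ≤ s → s ≤ 1 / 2 → auxS (fun k => 1 / (1 + a k)) 0 s
      = auxS (fun k => 1 / (1 + b k)) 0 s := by
    intro s _ hs
    rw [aux_conv a ha s hs, aux_conv b hb s hs, h (1 - s) (by linarith)]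
  have hM : ∀ m : ℕ, ∑' k, (2 : ℝ)⁻¹ ^ (k + 1) * (1 / (1 + a k)) ^ (m + 1)
      = ∑' k, (2 : ℝ)⁻¹ ^ (k + 1) * (1 / (1 + b k)) ^ (m + 1) := by
    intro m
    simpa using aux_moments2 _ _ (hu a ha) (hu b hb) hS m 0
  have fin : 1 / (1 + a k) = 1 / (1 + b k) := by
    induction k using Nat.strong_induction_on with
    | _ k ih =>
      exact le_antisymm (aux_le_s3 _ _ (hu a ha) (hu b hb) (anti b hb bm) hM k ih)
        (aux_le_s3 _ _ (hu b hb) (hu a ha) (anti a ha am) (fun m => (hM m).symm) k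
          (fun j hj => (ih j hj).symm))
  rw [one_div, one_div] at fin
  linarith [inv_injective fin]

/-- A linear operator on a space with an increasing family of seminorms `(pₖ)ₖ≥₁` is isometric
for the distance `d(x,y) = Σₖ 2⁻ᵏ pₖ(x−y)/(1 + pₖ(x−y))` iff it preserves every seminorm.
Here `p k` denotes the seminorm `p_{k+1}` of the family, so the sum over `k : ℕ` corresponds to
`Σ_{k=1}^∞ 2⁻ᵏ pₖ(x−y)/(1 + pₖ(x−y))`. -/
theorem stmt3 (X : Type*) [AddCommGroup X] [Module ℂ X]
    (p : ℕ → Seminorm ℂ X) (hmono : ∀ (k : ℕ) (x : X), p k x ≤ p (k + 1) x)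
    (d : X → X → ℝ)
    (hd : ∀ x y : X, d x y = ∑' k : ℕ, (2 : ℝ)⁻¹ ^ (k + 1) * (p k (x - y) / (1 + p k (x - y))))
    (T : X →ₗ[ℂ] X) :
    (∀ x y : X, d (T x) (T y) = d x y) ↔ ∀ (x : X) (k : ℕ), p k (T x) = p k x := by
  constructor
  · intro h x k
    refine aux_main (fun k => p k (T x)) (fun k => p k x) (fun k => apply_nonneg _ _)
      (fun k => apply_nonneg _ _) (monotone_nat_of_le_succ fun k => hmono k _)
      (monotone_nat_of_le_succ fun k => hmono k _) ?_ k
    intro t ht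
    have := h ((t : ℂ) • x) 0
    rw [hd, hd] at this
    simpa only [map_smul, map_zero, sub_zero, map_smul_eq_mul, Complex.norm_real,
      Real.norm_eq_abs, abs_of_pos ht] using this
  · intro h x y
    rw [hd, hd]
    simp only [← map_sub, h]
end
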